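/- Let (W,S) be a right-angled Coxeter system and let n ∈ ℕ. Then the set {w ∈ W : F#(w) ≤ n} is closed under squares: if w, ws, wt all have firmness ≤ n, where s, t ∈ S are distinct commuting generators with ℓ(ws) = ℓ(wt) = ℓ(w) + 1, then also F#(wst) ≤ n. -/

import Mathlib

/-- A Coxeter matrix is *right-angled* if all of its off-diagonal entries are equal to `2`
or to `0` (where `0` encodes `∞`, i.e. no relation). -/
def CoxeterMatrix.IsRightAngled {B : Type*} (M : CoxeterMatrix B) : Prop :=
  ∀ i j : B, i ≠ j → M i j = 2 ∨ M i j = 0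

/-- An element `w` of a Coxeter group is *firm* if there is a unique simple generator `r`
with `ℓ(w r) < ℓ(w)`.  (This forces `ℓ(w) ≥ 1`.) -/
def CoxeterSystem.IsFirm {B W : Type*} [Group W] {M : CoxeterMatrix B}
    (cs : CoxeterSystem M W) (w : W) : Prop :=
  ∃! r : B, cs.length (w * cs.simple r) < cs.length w

/-- The *firmness* `F#(w)` of an element `w` of a Coxeter group: the largest `k` such that
`w` admits a reduced representation whose prefix of length `k` represents a firm element
(of length `k`, automatically).  By convention `F#(1) = 0` (the case `k = 0`). -/
noncomputable def CoxeterSystem.firmness {B W : Type*} [Group W] {M : CoxeterMatrix B}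
    (cs : CoxeterSystem M W) (w : W) : ℕ :=
  sSup {k | ∃ ω : List B, cs.IsReduced ω ∧ cs.wordProd ω = w ∧ k ≤ ω.length ∧
    (k = 0 ∨ cs.IsFirm (cs.wordProd (ω.take k)))}

namespace CoxeterSystem

variable {B W : Type*} [Group W] {M : CoxeterMatrix B} (cs : CoxeterSystem M W)

/-- A map that squares to one on each generator and is compatible with the commutation relations
satisfies the relations of a right-angled Coxeter group. -/
theorem isLiftable_of_isRightAngled {G : Type*} [Monoid G] (hra : M.IsRightAngled) {f : B → G}
    (hsq : ∀ i, f i * f i = 1)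
    (hcomm : ∀ i j, i ≠ j → M i j = 2 → f i * f j * (f i * f j) = 1) :
    M.IsLiftable f := by
  intro i j
  by_cases hij : i = j
  · subst hij
    simp [hsq]
  · rcases hra i j hij with h | h
    · rw [h, pow_two, hcomm i j hij h]
    · rw [h, pow_zero]

theorem simple_mul_simple_comm {i j : B} (h : M i j = 2) :
    cs.simple i * cs.simple j = cs.simple j * cs.simple i := by
  have := cs.simple_mul_simple_pow i j
  rw [h, pow_two] at this
  rw [eq_inv_of_mul_eq_one_left this]
  simp

open Classical in
/-- The action of a generator on signed elements: conjugation, with a sign change exactly at the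
generator itself. -/
noncomputable def signedConj (i : B) : Function.End (W × ZMod 2) := fun x =>
  (cs.simple i * x.1 * cs.simple i, x.2 + if x.1 = cs.simple i then 1 else 0)

theorem isLiftable_signedConj (hra : M.IsRightAngled) : M.IsLiftable cs.signedConj := by
  refine isLiftable_of_isRightAngled hra (fun i => ?_) (fun i j _ hij => ?_)
  · funext ⟨x, e⟩
    have h : cs.simple i * x * cs.simple i = cs.simple i ↔ x = cs.simple i := by
      constructor
      · intro h
        simpa [mul_assoc] using congrArg (fun y => cs.simple i * y * cs.simple i) h
      · rintro rfl
        simp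
    change cs.signedConj i (cs.signedConj i (x, e)) = (x, e)
    simp only [signedConj, h, Prod.mk.injEq]
    refine ⟨by simp [mul_assoc], ?_⟩
    split_ifs <;> grind
  · have hc := cs.simple_mul_simple_comm hij
    have conj_eq : ∀ k l x, cs.simple k * cs.simple l = cs.simple l * cs.simple k →
        (cs.simple k * x * cs.simple k = cs.simple l ↔ x = cs.simple l) := by
      intro k l x hkl
      constructor
      · intro h
        have := congrArg (fun y => cs.simple k * y * cs.simple k) h
        simpa [mul_assoc, ← hkl] using this
      · rintro rfl
        rw [hkl]
        simp
    funext ⟨x, e⟩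
    change cs.signedConj i (cs.signedConj j (cs.signedConj i (cs.signedConj j (x, e)))) = (x, e)
    simp only [signedConj, conj_eq j i _ hc.symm, conj_eq i j _ hc, conj_eq i i _ rfl,
      conj_eq j j _ rfl, Prod.mk.injEq]
    constructor
    · have : cs.simple i * (cs.simple j * (cs.simple i * (cs.simple j * x * cs.simple j) *
          cs.simple i) * cs.simple j) * cs.simple i =
          (cs.simple i * cs.simple j) * (cs.simple i * cs.simple j) * x *
          ((cs.simple j * cs.simple i) * (cs.simple j * cs.simple i)) := by
        simp only [mul_assoc]
      have hsq := cs.simple_mul_simple_pow i j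
      rw [hij, pow_two] at hsq
      rw [this, ← hc, hsq, one_mul, mul_one]
    · split_ifs <;> grind

/-- The action of a right-angled Coxeter group on its signed elements. -/
noncomputable def signedConjHom (hra : M.IsRightAngled) : W →* Function.End (W × ZMod 2) :=
  cs.lift ⟨cs.signedConj, cs.isLiftable_signedConj hra⟩

theorem signedConjHom_simple (hra : M.IsRightAngled) (i : B) :
    cs.signedConjHom hra (cs.simple i) = cs.signedConj i :=
  cs.lift_apply_simple _ i

theorem signedConjHom_mul_apply (hra : M.IsRightAngled) (v w : W) (x : W × ZMod 2) :
    cs.signedConjHom hra (v * w) x = cs.signedConjHom hra v (cs.signedConjHom hra w x) := by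
  rw [map_mul]
  rfl

theorem signedConjHom_wordProd (hra : M.IsRightAngled) (ω : List B) (x : W) (e : ZMod 2) :
    (cs.signedConjHom hra (cs.wordProd ω) (x, e)).1 = cs.wordProd ω * x * (cs.wordProd ω)⁻¹ ∧
      (x ∉ cs.rightInvSeq ω → (cs.signedConjHom hra (cs.wordProd ω) (x, e)).2 = e) := by
  induction ω with
  | nil =>
    rw [wordProd_nil, map_one]
    change x = _ ∧ (_ → e = e)
    simp
  | cons i ω ih =>
    rw [wordProd_cons, signedConjHom_mul_apply, signedConjHom_simple]
    simp only [signedConj, rightInvSeq, List.mem_cons, not_or]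
    rw [ih.1]
    refine ⟨by simp [mul_assoc], fun ⟨h, h'⟩ => ?_⟩
    rw [ih.2 h', if_neg, add_zero]
    intro h''
    apply h
    rw [← h'']
    group

/-- The exchange condition, in a right-angled Coxeter group. -/
theorem simple_mem_rightInvSeq (hra : M.IsRightAngled) {ω : List B} {t : B}
    (h : cs.length (cs.wordProd ω * cs.simple t) < cs.length (cs.wordProd ω)) :
    cs.simple t ∈ cs.rightInvSeq ω := by
  by_contra hmem
  obtain ⟨ω', hω', hprod⟩ := cs.exists_isReduced (cs.wordProd ω * cs.simple t)
  have hmem' : cs.simple t ∉ cs.rightInvSeq ω' := by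
    intro h'
    have := (cs.isRightInversion_of_mem_rightInvSeq hω' h').2
    rw [← hprod] at this
    simp only [mul_assoc, simple_mul_simple_self, mul_one] at this
    omega
  have h₁ := (cs.signedConjHom_wordProd hra ω (cs.simple t) 0).2 hmem
  have h₂ := (cs.signedConjHom_wordProd hra ω' (cs.simple t) 1).2 hmem'
  have h₃ : cs.wordProd ω = cs.wordProd ω' * cs.simple t := by
    rw [← hprod]
    simp [mul_assoc]
  rw [h₃, signedConjHom_mul_apply, signedConjHom_simple] at h₁
  simp only [signedConj, simple_mul_simple_self, one_mul, if_true, zero_add] at h₁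
  rw [h₁] at h₂
  exact absurd h₂ (by decide)

/-- The exchange condition for a product of an element and a word: the deleted letter belongs to
one of the two factors. -/
theorem exchange_mul_wordProd (hra : M.IsRightAngled) {x : W} {υ : List B} {t : B}
    (h : cs.length (x * cs.wordProd υ * cs.simple t) < cs.length (x * cs.wordProd υ)) :
    (∃ x', cs.length x' < cs.length x ∧
      x * cs.wordProd υ * cs.simple t = x' * cs.wordProd υ) ∨
    ∃ υ' : List B, υ'.length < υ.length ∧ cs.wordProd υ * cs.simple t = cs.wordProd υ' := by
  obtain ⟨ω, hω, rfl⟩ := cs.exists_isReduced x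
  rw [← wordProd_append] at h
  obtain ⟨j, hj, hjt⟩ := List.mem_iff_getElem.mp (cs.simple_mem_rightInvSeq hra h)
  have key := cs.wordProd_mul_getD_rightInvSeq (ω ++ υ) j
  rw [List.getD_eq_getElem _ 1 hj, hjt] at key
  rw [length_rightInvSeq, List.length_append] at hj
  rcases lt_or_ge j ω.length with hlt | hge
  · left
    rw [List.eraseIdx_append_of_lt_length hlt, wordProd_append, wordProd_append] at key
    refine ⟨_, ?_, key⟩
    rw [hω.eq]
    refine (cs.length_wordProd_le _).trans_lt ?_
    rw [List.length_eraseIdx_of_lt hlt]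
    omega
  · right
    rw [List.eraseIdx_append_of_length_le hge, wordProd_append, wordProd_append, mul_assoc,
      mul_right_inj] at key
    refine ⟨_, ?_, key⟩
    rw [List.length_eraseIdx_of_lt (by omega)]
    omega

open Classical in
/-- The action of two generators on `ℤ` by reflections generating an infinite dihedral group. -/
noncomputable def lineReflection (a b i : B) : Function.End ℤ := fun n =>
  if i = b then 1 - n else if i = a then -1 - n else n

theorem isLiftable_lineReflection (hra : M.IsRightAngled) {a b : B} (hab : M a b = 0) :
    M.IsLiftable (lineReflection a b) := by
  have hba : M b a = 0 := by rw [M.symmetric, hab]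
  refine isLiftable_of_isRightAngled hra (fun i => ?_) (fun i j hne hij => ?_)
  · funext n
    change lineReflection a b i (lineReflection a b i n) = n
    simp only [lineReflection]
    split_ifs <;> omega
  · funext n
    change lineReflection a b i (lineReflection a b j (lineReflection a b i
      (lineReflection a b j n))) = n
    simp only [lineReflection]
    split_ifs <;> subst_vars <;> omega

theorem length_wordProd_alternatingWord (hra : M.IsRightAngled) {a b : B} (hab : M a b = 0)
    (m : ℕ) : cs.length (cs.wordProd (alternatingWord a b m)) = m := by
  have hne : a ≠ b := by
    rintro rfl
    simp at hab
  set φ := cs.lift ⟨lineReflection a b, isLiftable_lineReflection hra hab⟩ with hφ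
  have hcons : ∀ i ω n, φ (cs.wordProd (i :: ω)) n =
      lineReflection a b i (φ (cs.wordProd ω) n) := by
    intro i ω n
    rw [wordProd_cons, map_mul, hφ, lift_apply_simple]
    rfl
  have hnil : ∀ n, φ (cs.wordProd []) n = n := by
    intro n
    rw [wordProd_nil, map_one]
    rfl
  have isometry : ∀ ω n k, |φ (cs.wordProd ω) n - φ (cs.wordProd ω) k| = |n - k| := by
    intro ω n k
    induction ω with
    | nil => rw [hnil, hnil]
    | cons i ω ih =>
      rw [hcons, hcons, ← ih]
      simp only [lineReflection]
      split_ifs <;> grind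
  have bound : ∀ ω : List B, |φ (cs.wordProd ω) 0| ≤ ω.length := by
    intro ω
    induction ω using List.reverseRecOn with
    | nil => rw [hnil]; simp
    | append_singleton ω i ih =>
      have step : φ (cs.wordProd (ω ++ [i])) 0 =
          φ (cs.wordProd ω) (lineReflection a b i 0) := by
        rw [wordProd_append, wordProd_singleton, map_mul]
        nth_rewrite 3 [hφ]
        rw [← cs.lift_apply_simple (isLiftable_lineReflection hra hab) i]
        rfl
      have h := isometry ω (lineReflection a b i 0) 0
      have h' : |lineReflection a b i 0 - 0| ≤ 1 := by
        simp only [lineReflection]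
        split_ifs <;> simp
      rw [step, List.length_append, List.length_singleton]
      push_cast
      grind
  have value : ∀ m, φ (cs.wordProd (alternatingWord a b m)) 0 =
      if Even m then -(m : ℤ) else m := by
    intro m
    induction m with
    | zero => simpa [alternatingWord] using hnil 0
    | succ m ih =>
      rw [alternatingWord_succ', hcons, ih]
      by_cases hm : Even m
      · simp [hm, lineReflection, Nat.even_add_one, add_comm]
      · simp [hm, lineReflection, hne, Nat.even_add_one]
        ring
  apply le_antisymm
  · simpa using cs.length_wordProd_le (alternatingWord a b m)
  · obtain ⟨ω, hω, hprod⟩ := cs.exists_isReduced (cs.wordProd (alternatingWord a b m))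
    have h := bound ω
    rw [← hprod, value, ← hω.eq, ← hprod] at h
    split_ifs at h <;> simpa using h

/-- Two generators without a relation are not both right descents of the same element. -/
theorem not_descent_of_no_relation (hra : M.IsRightAngled) {a b : B} (hab : M a b = 0) {v : W}
    (ha : cs.length (v * cs.simple a) < cs.length v)
    (hb : cs.length (v * cs.simple b) < cs.length v) : False := by
  have factor : ∀ (m : ℕ) (a b : B), M a b = 0 →
      cs.length (v * cs.simple a) < cs.length v → cs.length (v * cs.simple b) < cs.length v →
      ∃ x, v = x * cs.wordProd (alternatingWord a b m) ∧ cs.length x + m ≤ cs.length v := by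
    intro m
    induction m with
    | zero => exact fun a b _ _ _ => ⟨v, by simp [alternatingWord]⟩
    | succ m ih =>
      intro a b hab ha hb
      obtain ⟨x, hx, hlen⟩ := ih b a (by rw [M.symmetric, hab]) hb ha
      have hb' := hb
      rw [hx] at hb'
      have hlast : cs.wordProd (alternatingWord a b (m + 1)) =
          cs.wordProd (alternatingWord b a m) * cs.simple b := by
        rw [alternatingWord_succ, wordProd_concat]
      rcases cs.exchange_mul_wordProd hra hb' with ⟨x', hx', heq⟩ | ⟨υ', hυ', heq⟩
      · refine ⟨x', ?_, by omega⟩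
        rw [hlast, ← mul_assoc, ← heq, ← hx]
        simp [mul_assoc]
      · have h := cs.length_wordProd_alternatingWord hra hab (m + 1)
        rw [hlast, heq] at h
        have := cs.length_wordProd_le υ'
        rw [length_alternatingWord] at hυ'
        omega
  obtain ⟨x, -, h⟩ := factor (cs.length v + 1) a b hab ha hb
  omega

/-- A right descent of a reduced product in a right-angled Coxeter group is a right descent of
one of the factors. -/
theorem descent_left_or_right (hra : M.IsRightAngled) (p : W) (t : B) (υ : List B)
    (hadd : cs.length (p * cs.wordProd υ) = cs.length p + υ.length)
    (h : cs.length (p * cs.wordProd υ * cs.simple t) < cs.length (p * cs.wordProd υ)) :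
    cs.length (p * cs.simple t) < cs.length p ∨
      cs.length (cs.wordProd υ * cs.simple t) < υ.length := by
  induction υ using List.reverseRecOn with
  | nil => simpa using h
  | append_singleton υ a ih =>
    have hυ := cs.length_wordProd_le υ
    simp only [List.length_append, List.length_singleton, wordProd_append, wordProd_singleton,
      ← mul_assoc] at hadd h ⊢
    by_cases hat : cs.simple a = cs.simple t
    · right
      rw [hat]
      simp only [mul_assoc, simple_mul_simple_self, mul_one]
      omega
    have hpυ := cs.length_mul_le p (cs.wordProd υ)
    have hadd' : cs.length (p * cs.wordProd υ) = cs.length p + υ.length := by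
      have := cs.length_mul_simple (p * cs.wordProd υ) a
      omega
    have ha : cs.length (p * cs.wordProd υ * cs.simple a * cs.simple a) <
        cs.length (p * cs.wordProd υ * cs.simple a) := by
      simp only [mul_assoc, simple_mul_simple_self, mul_one] at hadd hadd' ⊢
      omega
    have hne : a ≠ t := fun h => hat (by rw [h])
    have hc : cs.simple a * cs.simple t = cs.simple t * cs.simple a := by
      rcases hra a t hne with h2 | h0
      · exact cs.simple_mul_simple_comm h2
      · exact (cs.not_descent_of_no_relation hra h0 ha h).elim
    have hdesc : cs.length (p * cs.wordProd υ * cs.simple t) <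
        cs.length (p * cs.wordProd υ) := by
      have h' := h
      rw [← cs.wordProd_singleton a] at h'
      rcases cs.exchange_mul_wordProd hra h' with ⟨x', hx', heq⟩ | ⟨υ', hυ', heq⟩
      · have : p * cs.wordProd υ * cs.simple t = x' := by
          rw [wordProd_singleton, mul_assoc, hc, ← mul_assoc] at heq
          exact mul_right_cancel heq
        rwa [this]
      · have : υ' = [] := by
          simpa using hυ'
        rw [this, wordProd_nil, wordProd_singleton] at heq
        exact absurd (by simpa using eq_inv_of_mul_eq_one_left heq) hat
    rcases ih hadd' hdesc with h' | h'
    · exact Or.inl h'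
    · right
      rw [mul_assoc, hc, ← mul_assoc]
      have := cs.length_mul_simple (cs.wordProd υ * cs.simple t) a
      omega

/-- A firm prefix of a reduced word gives a lower bound for the firmness. -/
theorem le_firmness {ω : List B} {k : ℕ} (hω : cs.IsReduced ω) (hk : k ≤ ω.length)
    (hfirm : cs.IsFirm (cs.wordProd (ω.take k))) : k ≤ cs.firmness (cs.wordProd ω) := by
  refine le_csSup ⟨cs.length (cs.wordProd ω), ?_⟩ ⟨ω, hω, rfl, hk, Or.inr hfirm⟩
  rintro j ⟨ω', hω', heq, hj, -⟩
  rwa [← heq, hω'.eq]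

/-- A firm prefix of a reduced word survives the deletion of a right descent that is not a right
descent of the prefix. -/
theorem le_firmness_mul_simple (hra : M.IsRightAngled) {ω : List B} {k : ℕ} {t : B}
    (hω : cs.IsReduced ω) (hk : k ≤ ω.length) (hfirm : cs.IsFirm (cs.wordProd (ω.take k)))
    (hdesc : cs.length (cs.wordProd ω * cs.simple t) < cs.length (cs.wordProd ω))
    (hnot : ¬ cs.length (cs.wordProd (ω.take k) * cs.simple t) <
      cs.length (cs.wordProd (ω.take k))) :
    k ≤ cs.firmness (cs.wordProd ω * cs.simple t) := by
  have hsplit : cs.wordProd ω = cs.wordProd (ω.take k) * cs.wordProd (ω.drop k) := by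
    rw [← wordProd_append, List.take_append_drop]
  have hlen := hω.eq
  have htake : (ω.take k).length = k := List.length_take_of_le hk
  have hdrop : (ω.drop k).length = ω.length - k := List.length_drop
  have hp := (hω.take k).eq
  rw [htake] at hp
  have hright := (cs.descent_left_or_right hra (cs.wordProd (ω.take k)) t (ω.drop k)
    (by rw [← hsplit, hlen, hp, hdrop]; omega) (by rwa [← hsplit])).resolve_left hnot
  obtain ⟨υ, hυ, hprod⟩ := cs.exists_isReduced (cs.wordProd (ω.drop k) * cs.simple t)
  have heq : cs.wordProd ω * cs.simple t = cs.wordProd (ω.take k ++ υ) := by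
    rw [wordProd_append, ← hprod, hsplit, mul_assoc]
  rw [heq]
  have htk : (ω.take k ++ υ).take k = ω.take k := List.take_left' htake
  refine cs.le_firmness ?_ (by simp [hk]) (by rwa [htk])
  rw [hprod, hυ.eq] at hright
  have hle := cs.length_wordProd_le (ω.take k ++ υ)
  have := cs.length_mul_simple (cs.wordProd ω) t
  unfold IsReduced
  rw [← heq] at hle ⊢
  rw [List.length_append, htake] at hle ⊢
  omega

end CoxeterSystem

/-- The set `{w : F#(w) ≤ n}` is closed under squares: if `w`, `ws`, `wt` all have firmness
at most `n`, where `s ≠ t` are commuting generators with `ℓ(ws) = ℓ(wt) = ℓ(w) + 1`,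
then `F#(wst) ≤ n` as well. -/
theorem firmness_le_closed_under_squares {B W : Type*} [Group W] {M : CoxeterMatrix B}
    (cs : CoxeterSystem M W) (hra : M.IsRightAngled) (n : ℕ)
    (w : W) (s t : B) (hst : s ≠ t)
    (hcomm : cs.simple s * cs.simple t = cs.simple t * cs.simple s)
    (hls : cs.length (w * cs.simple s) = cs.length w + 1)
    (hlt : cs.length (w * cs.simple t) = cs.length w + 1)
    (h1 : cs.firmness w ≤ n)
    (h2 : cs.firmness (w * cs.simple s) ≤ n)
    (h3 : cs.firmness (w * cs.simple t) ≤ n) :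
    cs.firmness (w * cs.simple s * cs.simple t) ≤ n := by
  have hcomm' : w * cs.simple s * cs.simple t = w * cs.simple t * cs.simple s := by
    rw [mul_assoc, hcomm, mul_assoc]
  have hus : w * cs.simple s * cs.simple t * cs.simple s = w * cs.simple t := by
    rw [hcomm']
    simp [mul_assoc]
  have hut : w * cs.simple s * cs.simple t * cs.simple t = w * cs.simple s := by
    simp [mul_assoc]
  by_cases hst' : cs.simple s = cs.simple t
  · rw [← hst', mul_assoc, cs.simple_mul_simple_self, mul_one]
    exact h1
  refine csSup_le' ?_
  rintro k ⟨ω, hω, hprod, hk, rfl | hfirm⟩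
  · exact Nat.zero_le n
  have hlen : cs.length (w * cs.simple s * cs.simple t) = cs.length w + 2 := by
    have := cs.length_mul_simple (w * cs.simple s) t
    by_contra hlen
    have hlt' : cs.length (w * cs.wordProd [s] * cs.simple t) <
        cs.length (w * cs.wordProd [s]) := by
      rw [cs.wordProd_singleton]
      omega
    rcases cs.exchange_mul_wordProd hra hlt' with ⟨x, hx, heq⟩ | ⟨υ, hυ, heq⟩
    · rw [cs.wordProd_singleton, hcomm'] at heq
      rw [mul_right_cancel heq] at hlt
      omega
    · have : υ = [] := by simpa using hυ
      rw [this, cs.wordProd_nil, cs.wordProd_singleton] at heq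
      exact hst' (by simpa using eq_inv_of_mul_eq_one_left heq)
  rw [← hprod] at hus hut hlen
  by_cases hs : cs.length (cs.wordProd (ω.take k) * cs.simple s) <
      cs.length (cs.wordProd (ω.take k))
  · have ht : ¬ cs.length (cs.wordProd (ω.take k) * cs.simple t) <
        cs.length (cs.wordProd (ω.take k)) := fun ht => hst (hfirm.unique hs ht)
    have := cs.le_firmness_mul_simple hra hω hk hfirm (by rw [hut]; omega) ht
    rw [hut] at this
    exact this.trans h2
  · have := cs.le_firmness_mul_simple hra hω hk hfirm (by rw [hus]; omega) hs
    rw [hus] at this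
    exact this.trans h3
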